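/- arXiv:1912.03852 — 2 statements merged into one kernel-verified Lean document; each statement's English description precedes it below -/
import Mathlib

section
/- For every real number n > 1, the improper integral ∫₀^∞ sin(x^n) dx converges and equals Γ(1 + 1/n) · sin(π/(2n)); that is, ∫_{(0,T]} sin(x^n) dx → Γ(1 + 1/n) · sin(π/(2n)) as T → ∞, where Γ denotes the Gamma function and x^n denotes the real power of x. -/
open Real MeasureTheory Set Filter Topology

lemma aux_norm (n : ℝ) (c : ℂ) (x : ℝ) :
    ‖Complex.exp (-c * ((x ^ n : ℝ) : ℂ))‖ = Real.exp (-c.re * x ^ n) := by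
  rw [Complex.norm_exp]
  simp

lemma aux_meas (n : ℝ) (hn : 1 < n) (c : ℂ) :
    Continuous (fun x : ℝ => Complex.exp (-c * ((x ^ n : ℝ) : ℂ))) := by
  have : Continuous (fun x : ℝ => x ^ n) := continuous_rpow_const (by linarith)
  fun_prop

lemma aux_int (n : ℝ) (hn : 1 < n) (c : ℂ) (hc : 0 < c.re) :
    IntegrableOn (fun x : ℝ => Complex.exp (-c * ((x ^ n : ℝ) : ℂ))) (Ioi 0) := by
  have h := integrableOn_rpow_mul_exp_neg_mul_rpow (p := n) (s := 0) (b := c.re)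
    (by norm_num) (by linarith) hc
  refine Integrable.mono' h (aux_meas n hn c).aestronglyMeasurable ?_
  refine Eventually.of_forall fun x => ?_
  rw [aux_norm]
  simp

lemma aux_diff (n : ℝ) (hn : 1 < n) (c : ℂ) (hc : 0 < c.re) :
    DifferentiableAt ℂ
      (fun c : ℂ => ∫ x in Ioi (0:ℝ), Complex.exp (-c * ((x ^ n : ℝ) : ℂ))) c := by
  have hb := integrableOn_rpow_mul_exp_neg_mul_rpow (p := n) (s := n) (b := c.re / 2)
    (by linarith) (by linarith) (by linarith)
  have hcont : Continuous (fun x : ℝ => x ^ n) := continuous_rpow_const (by linarith)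
  have key := hasDerivAt_integral_of_dominated_loc_of_deriv_le
    (μ := volume.restrict (Ioi (0:ℝ))) (𝕜 := ℂ)
    (F := fun (c : ℂ) (x : ℝ) => Complex.exp (-c * ((x ^ n : ℝ) : ℂ)))
    (F' := fun (c : ℂ) (x : ℝ) => Complex.exp (-c * ((x ^ n : ℝ) : ℂ)) * (-((x ^ n : ℝ) : ℂ)))
    (x₀ := c) (s := {z : ℂ | c.re / 2 < z.re})
    (bound := fun x => x ^ n * Real.exp (-(c.re / 2) * x ^ n))
    ((isOpen_lt continuous_const Complex.continuous_re).mem_nhds (by simp; linarith))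
    (Eventually.of_forall fun z => (aux_meas n hn z).aestronglyMeasurable)
    (aux_int n hn c hc)
    (by
      apply Continuous.aestronglyMeasurable
      fun_prop)
    (by
      refine (ae_restrict_iff' measurableSet_Ioi).2 (Eventually.of_forall fun x hx z hz => ?_)
      have hx' : 0 ≤ x ^ n := rpow_nonneg (le_of_lt hx) n
      rw [norm_mul, aux_norm, norm_neg, Complex.norm_real, Real.norm_of_nonneg hx', mul_comm]
      have hz' : c.re / 2 < z.re := hz
      gcongr)
    hb
    (by
      refine Eventually.of_forall fun x z hz => ?_
      have h1 : HasDerivAt (fun z : ℂ => -z * ((x ^ n : ℝ) : ℂ)) (-((x ^ n : ℝ) : ℂ)) z := by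
        simpa using (hasDerivAt_id z).neg.mul_const ((x ^ n : ℝ) : ℂ)
      exact h1.cexp)
  exact key.2.differentiableAt

lemma aux_eq (n : ℝ) (hn : 1 < n) (c : ℂ) (hc : 0 < c.re) :
    ∫ x in Ioi (0:ℝ), Complex.exp (-c * ((x ^ n : ℝ) : ℂ))
      = c ^ ((-1 / n : ℝ) : ℂ) * (Real.Gamma (1 + 1 / n) : ℂ) := by
  have ho : IsOpen {z : ℂ | 0 < z.re} := isOpen_lt continuous_const Complex.continuous_re
  have hf : AnalyticOnNhd ℂ (fun c : ℂ => ∫ x in Ioi (0:ℝ), Complex.exp (-c * ((x ^ n : ℝ) : ℂ)))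
      {z : ℂ | 0 < z.re} :=
    DifferentiableOn.analyticOnNhd (fun z hz => (aux_diff n hn z hz).differentiableWithinAt) ho
  have hg : AnalyticOnNhd ℂ (fun c : ℂ => c ^ ((-1 / n : ℝ) : ℂ) * (Real.Gamma (1 + 1 / n) : ℂ))
      {z : ℂ | 0 < z.re} := by
    refine DifferentiableOn.analyticOnNhd (fun z hz => ?_) ho
    refine DifferentiableAt.differentiableWithinAt ?_
    refine DifferentiableAt.mul_const ?_ _
    exact DifferentiableAt.cpow_const differentiableAt_id (Or.inl hz)
  have hpre : IsPreconnected {z : ℂ | 0 < z.re} := (convex_halfSpace_re_gt 0).isPreconnected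
  refine hf.eqOn_of_preconnected_of_frequently_eq hg hpre (z₀ := 1) (by simp) ?_ hc
  have hreal : ∀ b : ℝ, 0 < b →
      ∫ x in Ioi (0:ℝ), Complex.exp (-(b : ℂ) * ((x ^ n : ℝ) : ℂ))
      = (b : ℂ) ^ ((-1 / n : ℝ) : ℂ) * (Real.Gamma (1 + 1 / n) : ℂ) := by
    intro b hb
    have h := integral_exp_neg_mul_rpow (p := n) (b := b) (by linarith) hb
    rw [← Complex.ofReal_cpow hb.le, ← Complex.ofReal_mul, add_comm, ← h, ← integral_complex_ofReal]
    simp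
  have ht : Tendsto (fun b : ℝ => (b : ℂ)) (𝓝[>] 1) (𝓝[≠] (1:ℂ)) := by
    refine tendsto_nhdsWithin_iff.2 ⟨?_, ?_⟩
    · have := (Complex.continuous_ofReal.tendsto (1:ℝ)).mono_left (nhdsWithin_le_nhds (s := Ioi 1))
      simpa using this
    · filter_upwards [self_mem_nhdsWithin] with b hb
      have : (b : ℝ) ≠ 1 := ne_of_gt hb
      simpa using this
  refine ht.frequently (Eventually.frequently ?_)
  filter_upwards [self_mem_nhdsWithin] with b hb
  exact hreal b (lt_trans one_pos hb)

lemma aux_tail (n : ℝ) (hn : 1 < n) (c : ℂ) (hc : 0 < c.re) (hc1 : 1 ≤ ‖c‖) (T : ℝ) (hT : 0 < T) :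
    ‖∫ x in Ioi T, Complex.exp (-c * ((x ^ n : ℝ) : ℂ))‖ ≤ 2 * T ^ (1 - n) := by
  have hc0 : c ≠ 0 := by intro h; simp [h] at hc
  have hn0 : (n : ℂ) ≠ 0 := by exact_mod_cast (by linarith : n ≠ 0)
  set e : ℝ → ℂ := fun x => Complex.exp (-c * ((x ^ n : ℝ) : ℂ)) with he
  have hecont : Continuous e := aux_meas n hn c
  have hle : ∀ x, 0 < x → ‖e x‖ ≤ 1 := by
    intro x hx
    rw [he]; simp only
    rw [aux_norm]
    apply Real.exp_le_one_iff.2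
    have := rpow_nonneg hx.le n
    nlinarith
  have hint : IntegrableOn e (Ioi T) := (aux_int n hn c hc).mono_set (Ioi_subset_Ioi hT.le)
  have hpow : IntegrableOn (fun x : ℝ => x ^ (-n)) (Ioi T) :=
    integrableOn_Ioi_rpow_of_lt (by linarith) hT
  set g : ℝ → ℂ := fun x => e x * ((x ^ (-n) : ℝ) : ℂ) with hgdef
  have hgle : ∀ x, 0 < x → ‖g x‖ ≤ x ^ (-n) := by
    intro x hx
    rw [hgdef]; simp only
    rw [norm_mul, Complex.norm_real, Real.norm_of_nonneg (rpow_nonneg hx.le _)]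
    exact mul_le_of_le_one_left (rpow_nonneg hx.le _) (hle x hx)
  have hgae : ∀ᵐ x ∂(volume.restrict (Ioi T)), ‖g x‖ ≤ x ^ (-n) :=
    (ae_restrict_iff' measurableSet_Ioi).2 (Eventually.of_forall fun x hx => hgle x (hT.trans hx))
  have hgint : IntegrableOn g (Ioi T) := by
    refine Integrable.mono' hpow ?_ hgae
    refine hecont.aestronglyMeasurable.mul ?_
    exact (Complex.measurable_ofReal.comp (measurable_id.pow_const _)).aestronglyMeasurable
  set h : ℝ → ℂ := fun x => -(1 / (c * n)) * (e x * ((x ^ (1 - n) : ℝ) : ℂ)) with hh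
  have hd : ∀ x ∈ Ici T, HasDerivAt h (e x + ((n - 1) / (c * n)) * g x) x := by
    intro x hx
    have hx0 : 0 < x := lt_of_lt_of_le hT hx
    have h1 : HasDerivAt (fun x : ℝ => ((x ^ n : ℝ) : ℂ)) ((n * x ^ (n - 1) : ℝ) : ℂ) x :=
      (Real.hasDerivAt_rpow_const (Or.inl hx0.ne')).ofReal_comp
    have h2 : HasDerivAt (fun x : ℝ => ((x ^ (1 - n) : ℝ) : ℂ))
        (((1 - n) * x ^ (1 - n - 1) : ℝ) : ℂ) x :=
      (Real.hasDerivAt_rpow_const (Or.inl hx0.ne')).ofReal_comp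
    have h3 : HasDerivAt e (e x * (-c * ((n * x ^ (n - 1) : ℝ) : ℂ))) x :=
      (h1.const_mul (-c)).cexp
    have h4 := (h3.mul h2).const_mul (-(1 / (c * n)))
    refine h4.congr_deriv ?_
    have e1 : (1 - n - 1 : ℝ) = -n := by ring
    have e2 : ((x ^ (n - 1) : ℝ) : ℂ) * ((x ^ (1 - n) : ℝ) : ℂ) = 1 := by
      rw [← Complex.ofReal_mul, ← rpow_add hx0]; simp
    rw [e1, hgdef]
    push_cast at e2 ⊢
    field_simp
    linear_combination (c * n * e x) * e2
  have hlim : Tendsto h atTop (𝓝 0) := by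
    have h0 : Tendsto (fun x : ℝ => ‖1 / (c * n)‖ * x ^ (1 - n)) atTop (𝓝 0) := by
      have := (tendsto_rpow_neg_atTop (by linarith : 0 < n - 1)).const_mul ‖1 / (c * n)‖
      simpa using this
    refine squeeze_zero_norm' ?_ h0
    filter_upwards [eventually_gt_atTop 0] with x hx
    rw [hh]; simp only
    rw [norm_mul, norm_neg, norm_mul, Complex.norm_real, Real.norm_of_nonneg (rpow_nonneg hx.le _)]
    gcongr
    exact mul_le_of_le_one_left (rpow_nonneg hx.le _) (hle x hx)
  have hI := integral_Ioi_of_hasDerivAt_of_tendsto' hd (hint.add (hgint.const_mul _)) hlim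
  rw [integral_add hint (hgint.const_mul _), integral_const_mul] at hI
  have hI' : ∫ x in Ioi T, e x = -h T - ((n - 1) / (c * n)) * ∫ x in Ioi T, g x := by
    linear_combination hI
  rw [hI']
  have b1 : ‖∫ x in Ioi T, g x‖ ≤ T ^ (1 - n) / (n - 1) := by
    refine (norm_integral_le_of_norm_le hpow hgae).trans (le_of_eq ?_)
    rw [integral_Ioi_rpow_of_lt (by linarith) hT, show -n + 1 = 1 - n by ring,
      show 1 - n = -(n - 1) by ring, div_neg, neg_div, neg_neg]
  have hTp : 0 ≤ T ^ (1 - n) := rpow_nonneg hT.le _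
  have hcn : 1 ≤ ‖c‖ * n := by nlinarith
  have nn : ‖c * n‖ = ‖c‖ * n := by
    rw [norm_mul, Complex.norm_real, Real.norm_of_nonneg (by linarith)]
  have b2 : ‖h T‖ ≤ T ^ (1 - n) := by
    rw [hh]; simp only
    rw [norm_mul, norm_neg, norm_mul, Complex.norm_real, Real.norm_of_nonneg hTp, norm_div, nn,
      norm_one]
    have : 1 / (‖c‖ * n) ≤ 1 := by
      rw [div_le_one (by linarith)]; exact hcn
    have h5 : ‖e T‖ * T ^ (1 - n) ≤ T ^ (1 - n) := mul_le_of_le_one_left hTp (hle T hT)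
    exact (mul_le_of_le_one_left (by positivity) this).trans h5
  have b3 : ‖((n - 1) / (c * n)) * ∫ x in Ioi T, g x‖ ≤ T ^ (1 - n) := by
    have h6 : ‖((n : ℂ) - 1)‖ = n - 1 := by
      rw [← Complex.ofReal_one, ← Complex.ofReal_sub, Complex.norm_real,
        Real.norm_of_nonneg (by linarith)]
    rw [norm_mul, norm_div, nn, h6]
    have h7 : (n - 1) / (‖c‖ * n) ≤ n - 1 := div_le_self (by linarith) hcn
    calc _ ≤ (n - 1) * (T ^ (1 - n) / (n - 1)) := by
          apply mul_le_mul h7 b1 (norm_nonneg _) (by linarith)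
      _ = _ := by
          have : n - 1 ≠ 0 := by linarith
          field_simp
  calc _ ≤ ‖-h T‖ + _ := norm_sub_le _ _
    _ ≤ T ^ (1 - n) + T ^ (1 - n) := by rw [norm_neg]; exact add_le_add b2 b3
    _ = _ := by ring

lemma aux_bound (n : ℝ) (hn : 1 < n) (T : ℝ) (hT : 0 < T) :
    ‖(-Complex.I) ^ ((-1 / n : ℝ) : ℂ) * (Real.Gamma (1 + 1 / n) : ℂ)
      - ∫ x in Ioc 0 T, Complex.exp (Complex.I * ((x ^ n : ℝ) : ℂ))‖ ≤ 2 * T ^ (1 - n) := by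
  have hc : Tendsto (fun ε : ℝ => (ε : ℂ) - Complex.I) (𝓝[>] 0) (𝓝 (-Complex.I)) := by
    have : Continuous (fun ε : ℝ => (ε : ℂ) - Complex.I) := by fun_prop
    have := (this.tendsto 0).mono_left (nhdsWithin_le_nhds (s := Ioi 0))
    simpa using this
  have h1 : Tendsto (fun ε : ℝ => ((ε : ℂ) - Complex.I) ^ ((-1 / n : ℝ) : ℂ) *
      (Real.Gamma (1 + 1 / n) : ℂ)) (𝓝[>] 0)
      (𝓝 ((-Complex.I) ^ ((-1 / n : ℝ) : ℂ) * (Real.Gamma (1 + 1 / n) : ℂ))) := by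
    refine Tendsto.mul_const _ (Tendsto.cpow hc tendsto_const_nhds ?_)
    simp [Complex.mem_slitPlane_iff]
  have h2 : Tendsto (fun ε : ℝ => ∫ x in Ioc 0 T,
      Complex.exp (-((ε : ℂ) - Complex.I) * ((x ^ n : ℝ) : ℂ))) (𝓝[>] 0)
      (𝓝 (∫ x in Ioc 0 T, Complex.exp (Complex.I * ((x ^ n : ℝ) : ℂ)))) := by
    refine tendsto_integral_filter_of_dominated_convergence (fun _ => 1) ?_ ?_ ?_ ?_
    · exact Eventually.of_forall fun ε => (aux_meas n hn _).aestronglyMeasurable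
    · filter_upwards [self_mem_nhdsWithin] with ε hε
      refine (ae_restrict_iff' measurableSet_Ioc).2 (Eventually.of_forall fun x hx => ?_)
      rw [aux_norm]
      apply Real.exp_le_one_iff.2
      have := rpow_nonneg hx.1.le n
      have hε' : 0 < ε := hε
      simp
      positivity
    · exact integrable_const _
    · refine Eventually.of_forall fun x => ?_
      have := ((hc.neg.mul_const ((x ^ n : ℝ) : ℂ))).cexp
      simpa using this
  refine le_of_tendsto (h1.sub h2).norm ?_
  filter_upwards [self_mem_nhdsWithin] with ε hε
  have hε' : 0 < ε := hε
  have hre : 0 < ((ε : ℂ) - Complex.I).re := by simpa using hε'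
  rw [← aux_eq n hn _ hre]
  have hi := aux_int n hn _ hre
  rw [← Ioc_union_Ioi_eq_Ioi hT.le, setIntegral_union (Ioc_disjoint_Ioi le_rfl) measurableSet_Ioi
    (hi.mono_set Ioc_subset_Ioi_self) (hi.mono_set (Ioi_subset_Ioi hT.le)), add_sub_cancel_left]
  refine aux_tail n hn _ hre ?_ T hT
  have := Complex.abs_im_le_norm ((ε : ℂ) - Complex.I)
  simpa using this

/-- For every real `n > 1`, the improper integral `∫₀^∞ sin (x ^ n) dx` converges and
equals `Γ(1 + 1/n) * sin (π / (2n))`. -/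
theorem stmt9 (n : ℝ) (hn : 1 < n) :
    (∀ T : ℝ, 0 < T →
      IntegrableOn (fun x : ℝ => Real.sin (x ^ n)) (Set.Ioc 0 T)) ∧
    Tendsto (fun T : ℝ => ∫ x in Set.Ioc 0 T, Real.sin (x ^ n))
      atTop (𝓝 (Real.Gamma (1 + 1 / n) * Real.sin (Real.pi / (2 * n)))) := by
  have hcont : Continuous (fun x : ℝ => x ^ n) := continuous_rpow_const (by linarith)
  constructor
  · intro T hT
    exact (Real.continuous_sin.comp hcont).integrableOn_Ioc
  have hexp : (-Complex.I) ^ ((-1 / n : ℝ) : ℂ) * (Real.Gamma (1 + 1 / n) : ℂ)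
      = Complex.exp ((Real.pi / (2 * n) : ℝ) * Complex.I) * (Real.Gamma (1 + 1 / n) : ℂ) := by
    rw [Complex.cpow_def_of_ne_zero (by simp), Complex.log_neg_I]
    congr 2
    have hn0 : (n : ℂ) ≠ 0 := by exact_mod_cast (by linarith : n ≠ 0)
    push_cast
    field_simp
  have hT0 : Tendsto (fun T : ℝ => 2 * T ^ (1 - n)) atTop (𝓝 0) := by
    have := (tendsto_rpow_neg_atTop (by linarith : 0 < n - 1)).const_mul 2
    simpa using this
  have hC : Tendsto (fun T : ℝ => ∫ x in Ioc 0 T, Complex.exp (Complex.I * ((x ^ n : ℝ) : ℂ)))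
      atTop (𝓝 (Complex.exp ((Real.pi / (2 * n) : ℝ) * Complex.I) *
        (Real.Gamma (1 + 1 / n) : ℂ))) := by
    rw [← hexp, tendsto_iff_norm_sub_tendsto_zero]
    refine squeeze_zero' (Eventually.of_forall fun _ => norm_nonneg _) ?_ hT0
    filter_upwards [eventually_gt_atTop 0] with T hT
    rw [norm_sub_rev]
    exact aux_bound n hn T hT
  have hIm := (Complex.continuous_im.tendsto _).comp hC
  rw [Complex.im_mul_ofReal, Complex.exp_ofReal_mul_I_im, mul_comm] at hIm
  refine hIm.congr fun T => ?_
  have hi : IntegrableOn (fun x : ℝ => Complex.exp (Complex.I * ((x ^ n : ℝ) : ℂ))) (Ioc 0 T) := by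
    apply Continuous.integrableOn_Ioc
    fun_prop
  have h8 := integral_im hi
  simp only [Function.comp]
  refine h8.symm.trans ?_
  refine integral_congr_ae (Eventually.of_forall fun x => ?_)
  simp only [RCLike.im_to_complex]
  rw [mul_comm, Complex.exp_ofReal_mul_I_im]
end

section
/- For every real number n > 1, the improper integral ∫₀^∞ cos(x^n) dx converges and equals Γ(1 + 1/n) · cos(π/(2n)); that is, ∫_{(0,T]} cos(x^n) dx → Γ(1 + 1/n) · cos(π/(2n)) as T → ∞, where Γ denotes the Gamma function and x^n denotes the real power of x. -/
open Real MeasureTheory Set Filter Topology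

/-- The integrand on the ray of angle `t`. -/
noncomputable def rayFun (n t r : ℝ) : ℂ :=
  Complex.exp (Complex.I * t) *
    Complex.exp (-((r ^ n : ℝ) : ℂ) * Complex.exp (Complex.I * (n * t)))

/-- Its derivative in the angle. -/
noncomputable def rayFun' (n t r : ℝ) : ℂ :=
  Complex.I * rayFun n t r * (1 - n * ((r ^ n : ℝ) : ℂ) * Complex.exp (Complex.I * (n * t)))

lemma rayFun_deriv_angle (n t r : ℝ) :
    HasDerivAt (fun t : ℝ => rayFun n t r) (rayFun' n t r) t := by
  have h0 : HasDerivAt (fun t : ℝ => (t : ℂ)) 1 t := Complex.ofRealCLM.hasDerivAt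
  have h1 := (h0.const_mul Complex.I).cexp
  have h2 := (((h0.const_mul (n : ℂ)).const_mul Complex.I).cexp.const_mul
    (-((r ^ n : ℝ) : ℂ))).cexp
  refine (h1.mul h2).congr_deriv ?_
  simp only [rayFun', rayFun]
  ring

lemma rayFun_deriv_radius (n t r : ℝ) (hn : 1 < n) (hr : 0 ≤ r) :
    HasDerivAt (fun r : ℝ => Complex.I * r * rayFun n t r) (rayFun' n t r) r := by
  have h0 : HasDerivAt (fun t : ℝ => (t : ℂ)) 1 r := Complex.ofRealCLM.hasDerivAt
  have h1 := (Real.hasDerivAt_rpow_const (x := r) (p := n) (Or.inr hn.le)).ofReal_comp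
  have h2 := ((h1.neg.mul_const (Complex.exp (Complex.I * (n * t)))).cexp).const_mul
    (Complex.exp (Complex.I * t))
  have hpow : ((r ^ n : ℝ) : ℂ) = r * ((r ^ (n - 1) : ℝ) : ℂ) := by
    rw [← Complex.ofReal_mul]
    congr 1
    rcases hr.eq_or_lt with h | h
    · rw [← h, Real.zero_rpow (by linarith)]; simp
    · rw [Real.rpow_sub_one h.ne']; field_simp
  refine ((h0.const_mul Complex.I).mul h2).congr_deriv ?_
  simp only [rayFun', rayFun, Pi.neg_apply]
  push_cast
  simp only [hpow]
  ring

lemma norm_rayFun (n t r : ℝ) :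
    ‖rayFun n t r‖ = Real.exp (-(r ^ n) * Real.cos (n * t)) := by
  have h : Complex.exp (Complex.I * (n * t)) = Complex.exp (((n * t : ℝ) : ℂ) * Complex.I) := by
    congr 1; push_cast; ring
  have h' : ‖Complex.exp (Complex.I * t)‖ = 1 := by
    rw [mul_comm]; exact Complex.norm_exp_ofReal_mul_I t
  rw [rayFun, norm_mul, h', one_mul, h, Complex.norm_exp]
  congr 1
  rw [← Complex.ofReal_neg, Complex.re_ofReal_mul, Complex.exp_ofReal_mul_I_re]

lemma norm_rayFun'_le (n t r T : ℝ) (hn : 1 < n) (hr : 0 ≤ r) (hrT : r ≤ T) :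
    ‖rayFun' n t r‖ ≤ Real.exp (T ^ n) * (1 + n * T ^ n) := by
  have h : ‖Complex.exp (Complex.I * (n * t))‖ = 1 := by
    have := Complex.norm_exp_ofReal_mul_I (n * t)
    rw [← this]; congr 2; push_cast; ring
  have hp : r ^ n ≤ T ^ n := Real.rpow_le_rpow hr hrT (by linarith)
  have hp0 : 0 ≤ r ^ n := Real.rpow_nonneg hr n
  rw [rayFun', norm_mul, norm_mul, Complex.norm_I, one_mul, norm_rayFun]
  have h1 : Real.exp (-(r ^ n) * Real.cos (n * t)) ≤ Real.exp (T ^ n) := by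
    apply Real.exp_le_exp.2
    nlinarith [Real.neg_one_le_cos (n * t)]
  have h2 : ‖1 - (n : ℂ) * ((r ^ n : ℝ) : ℂ) * Complex.exp (Complex.I * (n * t))‖
      ≤ 1 + n * T ^ n := by
    refine (norm_sub_le _ _).trans ?_
    rw [norm_mul, norm_mul, h, norm_one, Complex.norm_real, Complex.norm_real,
      Real.norm_of_nonneg hp0, Real.norm_of_nonneg (by linarith : 0 ≤ n)]
    nlinarith
  exact mul_le_mul h1 h2 (norm_nonneg _) (Real.exp_pos _).le

lemma continuous_rayFun (n t : ℝ) (hn : 1 < n) : Continuous (rayFun n t) := by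
  have h : Continuous (fun r : ℝ => r ^ n) := Real.continuous_rpow_const (by linarith)
  unfold rayFun
  fun_prop

lemma continuous_rayFun' (n t : ℝ) (hn : 1 < n) : Continuous (rayFun' n t) := by
  have h : Continuous (fun r : ℝ => r ^ n) := Real.continuous_rpow_const (by linarith)
  have h' := continuous_rayFun n t hn
  unfold rayFun'
  fun_prop

lemma integral_deriv (n t T : ℝ) (hn : 1 < n) (hT : 0 < T) :
    HasDerivAt (fun t : ℝ => ∫ r in (0 : ℝ)..T, rayFun n t r)
      (Complex.I * T * rayFun n t T) t := by
  have key := (intervalIntegral.hasDerivAt_integral_of_dominated_loc_of_deriv_le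
    (μ := volume) (F := fun t r => rayFun n t r) (F' := fun t r => rayFun' n t r)
    (a := 0) (b := T) (x₀ := t) (s := univ)
    (bound := fun _ => Real.exp (T ^ n) * (1 + n * T ^ n)) univ_mem
    (Eventually.of_forall fun t => (continuous_rayFun n t hn).aestronglyMeasurable)
    ((continuous_rayFun n t hn).intervalIntegrable _ _)
    (continuous_rayFun' n t hn).aestronglyMeasurable
    (Eventually.of_forall fun r hr t _ => by
      rw [uIoc_of_le hT.le] at hr
      exact norm_rayFun'_le n t r T hn hr.1.le hr.2)
    intervalIntegrable_const
    (Eventually.of_forall fun r _ t _ => rayFun_deriv_angle n t r)).2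
  refine key.congr_deriv ?_
  rw [intervalIntegral.integral_eq_sub_of_hasDerivAt
    (f := fun r : ℝ => Complex.I * r * rayFun n t r)
    (fun r hr => rayFun_deriv_radius n t r hn (by rw [uIcc_of_le hT.le] at hr; exact hr.1))
    ((continuous_rayFun' n t hn).intervalIntegrable _ _)]
  simp

lemma arc_bound (n T : ℝ) (hn : 1 < n) (hT : 0 < T) :
    ‖(∫ r in (0 : ℝ)..T, rayFun n (π / (2 * n)) r) - ∫ r in (0 : ℝ)..T, rayFun n 0 r‖
      ≤ π / (2 * n) * T ^ (-(n - 1)) := by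
  have hn0 : 0 < n := by linarith
  have hTn : 0 < T ^ n := Real.rpow_pos_of_pos hT n
  have hpi := Real.pi_pos
  have hB : ∀ t : ℝ, HasDerivAt
      (fun t : ℝ => T / (T ^ n * (2 * n / π)) * Real.exp (-(T ^ n) * (1 - 2 * n / π * t)))
      (T * Real.exp (-(T ^ n) * (1 - 2 * n / π * t))) t := by
    intro t
    have := (((((hasDerivAt_id t).const_mul (2 * n / π)).const_sub 1).const_mul
      (-(T ^ n))).exp).const_mul (T / (T ^ n * (2 * n / π)))
    refine this.congr_deriv ?_
    simp only [id]
    field_simp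
  have hd : ∀ t : ℝ, HasDerivAt (fun t : ℝ => (∫ r in (0 : ℝ)..T, rayFun n t r)
      - ∫ r in (0 : ℝ)..T, rayFun n 0 r) (Complex.I * T * rayFun n t T) t :=
    fun t => (integral_deriv n t T hn hT).sub_const _
  have := image_norm_le_of_norm_deriv_right_le_deriv_boundary
    (a := 0) (b := π / (2 * n))
    (fun t _ => (hd t).continuousAt.continuousWithinAt)
    (fun t _ => (hd t).hasDerivWithinAt) (by simp only [sub_self, norm_zero]; positivity) hB
    (fun t ht => by
      rw [norm_mul, norm_mul, Complex.norm_I, one_mul, norm_rayFun, Complex.norm_real,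
        Real.norm_of_nonneg hT.le]
      have h1 : n * t ≤ π / 2 := by
        have := ht.2.le
        rw [le_div_iff₀ (by positivity)] at this
        linarith
      have h2 := Real.one_sub_mul_le_cos (mul_nonneg hn0.le ht.1) h1
      have h3 : 2 * n / π * t = 2 / π * (n * t) := by ring
      rw [h3]
      gcongr T * Real.exp ?_
      nlinarith)
    (right_mem_Icc.2 (by positivity))
  refine this.trans (le_of_eq ?_)
  have h4 : (1 : ℝ) - 2 * n / π * (π / (2 * n)) = 0 := by field_simp; ring
  rw [h4, neg_sub, Real.rpow_sub hT, Real.rpow_one]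
  simp
  field_simp

/-- For every real `n > 1`, the improper integral `∫₀^∞ cos (x ^ n) dx` converges and
equals `Γ(1 + 1/n) * cos (π / (2n))`. -/
theorem stmt10 (n : ℝ) (hn : 1 < n) :
    (∀ T : ℝ, 0 < T →
      IntegrableOn (fun x : ℝ => Real.cos (x ^ n)) (Set.Ioc 0 T)) ∧
    Tendsto (fun T : ℝ => ∫ x in Set.Ioc 0 T, Real.cos (x ^ n))
      atTop (𝓝 (Real.Gamma (1 + 1 / n) * Real.cos (Real.pi / (2 * n)))) := by
  have hn0 : 0 < n := by linarith
  have hc : Continuous (fun r : ℝ => r ^ n) := Real.continuous_rpow_const (by linarith)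
  constructor
  · intro T hT
    exact ((Real.continuous_cos.comp hc).integrableOn_Icc (a := 0) (b := T)).mono_set
      Ioc_subset_Icc_self
  have h0 : Tendsto (fun T : ℝ => ∫ r in (0 : ℝ)..T, rayFun n 0 r) atTop
      (𝓝 ((Real.Gamma (1 + 1 / n) : ℝ) : ℂ)) := by
    have hi : IntegrableOn (fun x : ℝ => Real.exp (-x ^ n)) (Ioi 0) := by
      simpa using integrableOn_rpow_mul_exp_neg_rpow (s := 0) (by norm_num) hn0
    have := intervalIntegral_tendsto_integral_Ioi (0 : ℝ) hi tendsto_id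
    rw [integral_exp_neg_rpow hn0, add_comm] at this
    refine ((Complex.continuous_ofReal.tendsto _).comp this).congr fun T => ?_
    simp only [Function.comp, id]
    rw [← intervalIntegral.integral_ofReal]
    simp [rayFun]
  have h1 : Tendsto (fun T : ℝ => (∫ r in (0 : ℝ)..T, rayFun n (π / (2 * n)) r)
      - ∫ r in (0 : ℝ)..T, rayFun n 0 r) atTop (𝓝 0) := by
    have hb : Tendsto (fun T : ℝ => π / (2 * n) * T ^ (-(n - 1))) atTop (𝓝 0) := by
      simpa using (tendsto_rpow_neg_atTop (y := n - 1) (by linarith)).const_mul (π / (2 * n))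
    refine squeeze_zero_norm' ?_ hb
    filter_upwards [eventually_gt_atTop 0] with T hT using arc_bound n T hn hT
  have h2 : Tendsto (fun T : ℝ => ∫ r in (0 : ℝ)..T, rayFun n (π / (2 * n)) r) atTop
      (𝓝 ((Real.Gamma (1 + 1 / n) : ℝ) : ℂ)) := by
    simpa using h1.add h0
  have h3 := (Complex.continuous_re.tendsto _).comp
    (h2.const_mul (Complex.exp (((-(π / (2 * n)) : ℝ) : ℂ) * Complex.I)))
  rw [Complex.re_mul_ofReal, Complex.exp_ofReal_mul_I_re, Real.cos_neg] at h3
  rw [mul_comm (Real.Gamma (1 + 1 / n))]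
  refine h3.congr' ?_
  filter_upwards [eventually_gt_atTop 0] with T hT
  simp only [Function.comp]
  rw [← intervalIntegral.integral_of_le hT.le, ← intervalIntegral.integral_const_mul]
  have hr : ∀ r : ℝ, Complex.exp (((-(π / (2 * n)) : ℝ) : ℂ) * Complex.I) *
      rayFun n (π / (2 * n)) r = Complex.exp (((-(r ^ n) : ℝ) : ℂ) * Complex.I) := by
    intro r
    have e : Complex.exp (Complex.I * (n * ((π / (2 * n) : ℝ) : ℂ))) = Complex.I := by
      refine Eq.trans (congrArg Complex.exp ?_) Complex.exp_pi_div_two_mul_I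
      have : (n : ℂ) ≠ 0 := by exact_mod_cast hn0.ne'
      push_cast
      field_simp
    rw [rayFun, e, ← mul_assoc, ← Complex.exp_add, ← Complex.exp_add]
    congr 1
    push_cast
    ring
  simp_rw [hr]
  have hII : IntervalIntegrable
      (fun r : ℝ => Complex.exp (((-(r ^ n) : ℝ) : ℂ) * Complex.I)) volume 0 T :=
    Continuous.intervalIntegrable (by fun_prop) _ _
  have := Complex.reCLM.intervalIntegral_comp_comm hII
  simp only [Complex.reCLM_apply] at this
  rw [← this]
  simp only [Complex.exp_ofReal_mul_I_re, Real.cos_neg]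
end
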